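/- arXiv:1109.2415 — 5 statements merged into one kernel-verified Lean document; each statement's English description precedes it below -/
import Mathlib

section
/- Let {u_k}_{k≥0} be a nonnegative real sequence, {S_k}_{k≥0} an increasing real sequence with S_0 ≥ u_0², and λ_i ≥ 0 for all i ≥ 1. Assume that for all k ≥ 1 the recursion u_k² ≤ S_k + Σ_{i=1}^k λ_i u_i holds. Then for all k ≥ 1, u_k ≤ (1/2) Σ_{i=1}^k λ_i + ( S_k + ((1/2) Σ_{i=1}^k λ_i)² )^{1/2}. -/
open scoped RealInnerProductSpace
open Finset

noncomputable section

variable {E : Type*} [NormedAddCommGroup E] [InnerProductSpace ℝ E] [CompleteSpace E]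

/-- The ε-subdifferential of an `EReal`-valued function `a` at `x`:
the set of `y` such that `a t ≥ a x + ⟪y, t - x⟫ - ε` for all `t`. -/
def epsSubdiff (a : E → EReal) (ε : ℝ) (x : E) : Set E :=
  {y | ∀ t : E, a x + ((⟪y, t - x⟫ : ℝ) : EReal) - ((ε : ℝ) : EReal) ≤ a t}

/-- The objective function of the proximal problem at `y`. -/
def proxObj (L : ℝ) (h : E → EReal) (y x : E) : EReal :=
  ((L / 2 * ‖x - y‖ ^ 2 : ℝ) : EReal) + h x

/-- `x` is an `ε`-optimal solution of the proximal problem at `y`. -/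
def IsEpsOptimal (L : ℝ) (h : E → EReal) (ε : ℝ) (y x : E) : Prop :=
  proxObj L h y x ≤ ((ε : ℝ) : EReal) + ⨅ z : E, proxObj L h y z

/-- Convexity for `EReal`-valued functions. -/
def ERealConvexOn (h : E → EReal) : Prop :=
  ∀ x y : E, ∀ a b : ℝ, 0 ≤ a → 0 ≤ b → a + b = 1 →
    h (a • x + b • y) ≤ ((a : ℝ) : EReal) * h x + ((b : ℝ) : EReal) * h y

theorem stmt_0 (u S lam : ℕ → ℝ)
    (hu : ∀ k, 0 ≤ u k)
    (hS : ∀ k, S k ≤ S (k + 1))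
    (hS0 : u 0 ^ 2 ≤ S 0)
    (hlam : ∀ i, 1 ≤ i → 0 ≤ lam i)
    (hrec : ∀ k, 1 ≤ k → u k ^ 2 ≤ S k + ∑ i ∈ Icc 1 k, lam i * u i) :
    ∀ k, 1 ≤ k →
      u k ≤ (1 / 2) * ∑ i ∈ Icc 1 k, lam i +
        Real.sqrt (S k + ((1 / 2) * ∑ i ∈ Icc 1 k, lam i) ^ 2) := by
  intro k hk
  obtain ⟨m, hm, hmax⟩ := exists_max_image (Icc 1 k) u ⟨k, mem_Icc.mpr ⟨hk, le_rfl⟩⟩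
  obtain ⟨hm1, hmk⟩ := mem_Icc.mp hm
  have hsum : ∑ i ∈ Icc 1 m, lam i * u i ≤ (∑ i ∈ Icc 1 k, lam i) * u m := by
    rw [sum_mul]
    calc ∑ i ∈ Icc 1 m, lam i * u i
        ≤ ∑ i ∈ Icc 1 k, lam i * u i :=
          sum_le_sum_of_subset_of_nonneg (Icc_subset_Icc_right hmk)
            fun i hi _ => mul_nonneg (hlam i (mem_Icc.mp hi).1) (hu i)
      _ ≤ ∑ i ∈ Icc 1 k, lam i * u m :=
          sum_le_sum fun i hi =>
            mul_le_mul_of_nonneg_left (hmax i hi) (hlam i (mem_Icc.mp hi).1)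
  have hSm : S m ≤ S k := monotone_nat_of_le_succ hS hmk
  have hquad : (u m - 1 / 2 * ∑ i ∈ Icc 1 k, lam i) ^ 2 ≤
      S k + (1 / 2 * ∑ i ∈ Icc 1 k, lam i) ^ 2 := by
    linarith [hrec m hm1]
  linarith [hmax k (mem_Icc.mpr ⟨hk, le_rfl⟩), Real.le_sqrt_of_sq_le hquad]
end
end

section
/- Suppose x ∈ E is an ε-optimal solution of the proximal problem at z ∈ E, i.e. (L/2)‖x − z‖² + h(x) ≤ ε + inf_{w ∈ E} [(L/2)‖w − z‖² + h(w)]. Then there exists f ∈ E with ‖f‖ ≤ √(2ε/L) such that L(z − x − f) ∈ ∂_ε h(x). In particular, if z = y − (1/L)(g'(y) + e) for some y, e ∈ E, then there exists f with ‖f‖ ≤ √(2ε/L) and L( y − x − (1/L)(g'(y) + e) − f ) ∈ ∂_ε h(x). -/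
open scoped RealInnerProductSpace
open Finset

noncomputable section

variable {E : Type*} [NormedAddCommGroup E] [InnerProductSpace ℝ E] [CompleteSpace E]

omit [CompleteSpace E] in
/-- Convexity of an extended-real function, read on its epigraph. -/
lemma ERealConvexOn.le_coe {h : E → EReal} (hconv : ERealConvexOn h) {x y : E} {r s a b : ℝ}
    (hx : h x ≤ r) (hy : h y ≤ s) (ha : 0 ≤ a) (hb : 0 ≤ b) (hab : a + b = 1) :
    h (a • x + b • y) ≤ ((a * r + b * s : ℝ) : EReal) := by
  refine (hconv x y a b ha hb hab).trans ?_
  rw [EReal.coe_add, EReal.coe_mul, EReal.coe_mul]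
  exact add_le_add (mul_le_mul_of_nonneg_left hx (EReal.coe_nonneg.2 ha))
    (mul_le_mul_of_nonneg_left hy (EReal.coe_nonneg.2 hb))

open Filter Topology in
/-- A convex lower semicontinuous function on a Hilbert space, regularised by a quadratic that
makes its infimum `m` finite, attains that infimum. -/
lemma exists_prox_minimizer {L : ℝ} (hL : 0 < L) {h : E → EReal} (hconv : ERealConvexOn h)
    (hlsc : LowerSemicontinuous h) {z : E} {m : ℝ}
    (hm : ∀ (w : E) (r : ℝ), h w ≤ r → m ≤ L / 2 * ‖w - z‖ ^ 2 + r)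
    (happ : ∀ δ : ℝ, 0 < δ → ∃ (w : E) (r : ℝ), h w ≤ r ∧ L / 2 * ‖w - z‖ ^ 2 + r < m + δ) :
    ∃ p : E, h p ≤ ((m - L / 2 * ‖p - z‖ ^ 2 : ℝ) : EReal) := by
  have hdist : ∀ (u v : E) (r s δ : ℝ), h u ≤ r → h v ≤ s →
      L / 2 * ‖u - z‖ ^ 2 + r < m + δ → L / 2 * ‖v - z‖ ^ 2 + s < m + δ →
      L / 8 * ‖u - v‖ ^ 2 ≤ δ := by
    intro u v r s δ hu hv hur hvs
    have hmid := hm _ _ (hconv.le_coe hu hv (a := 1 / 2) (b := 1 / 2) (by norm_num) (by norm_num)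
      (by norm_num))
    have hpar := parallelogram_law_with_norm ℝ (u - z) (v - z)
    have hsub : u - z - (v - z) = u - v := by abel
    have hadd : (1 / 2 : ℝ) • u + (1 / 2 : ℝ) • v - z = (1 / 2 : ℝ) • (u - z + (v - z)) := by
      module
    rw [hadd, norm_smul, mul_pow] at hmid
    rw [hsub] at hpar
    norm_num at hmid
    have hparL := congrArg (fun x => L / 8 * x) hpar
    ring_nf at hparL hmid hur hvs ⊢
    linarith
  choose u r hur hu using fun n : ℕ => happ (1 / ((n : ℝ) + 1)) (by positivity)
  have hlim : Tendsto (fun n : ℕ => 1 / ((n : ℝ) + 1)) atTop (𝓝 0) :=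
    tendsto_one_div_add_atTop_nhds_zero_nat
  have hcauchy : CauchySeq u := by
    rw [Metric.cauchySeq_iff']
    intro η hη
    obtain ⟨N, hN⟩ := (hlim.eventually (gt_mem_nhds (show 0 < L / 8 * η ^ 2 by positivity))).exists
    refine ⟨N, fun n hn => ?_⟩
    have hmono : 1 / ((n : ℝ) + 1) ≤ 1 / ((N : ℝ) + 1) := by gcongr
    have hle := hdist (u n) (u N) (r n) (r N) _ (hur n) (hur N)
      ((hu n).trans_le (by gcongr)) (hu N)
    rw [dist_eq_norm]
    have hsq : ‖u n - u N‖ ^ 2 < η ^ 2 :=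
      lt_of_mul_lt_mul_left (hle.trans_lt hN) (by positivity)
    exact lt_of_pow_lt_pow_left₀ 2 hη.le hsq
  obtain ⟨p, hp⟩ := cauchySeq_tendsto_of_complete hcauchy
  refine ⟨p, EReal.le_of_forall_lt_iff_le.1 fun c hc => ?_⟩
  by_contra hcon
  have hev := hp.eventually (hlsc p c (not_le.1 hcon))
  have hbound : Tendsto (fun n : ℕ => m + 1 / ((n : ℝ) + 1) - L / 2 * ‖u n - z‖ ^ 2) atTop
      (𝓝 (m + 0 - L / 2 * ‖p - z‖ ^ 2)) :=
    (hlim.const_add m).sub ((((hp.sub_const z).norm).pow 2).const_mul _)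
  have hle : c ≤ m + 0 - L / 2 * ‖p - z‖ ^ 2 := by
    refine ge_of_tendsto hbound (hev.mono fun n hn => ?_)
    have hcr : c < r n := EReal.coe_lt_coe_iff.1 (hn.trans_le (hur n))
    linarith [hu n]
  have hc' := EReal.coe_lt_coe_iff.1 hc
  linarith

omit [CompleteSpace E] in
open Filter Topology in
/-- First-order optimality: `L • (z - p)` is a subgradient of `h` at a minimizer `p` of the
proximal problem at `z`. -/
lemma prox_minimizer_subgradient {L : ℝ} {h : E → EReal} (hconv : ERealConvexOn h)
    {z p : E} {m : ℝ} (hm : ∀ (w : E) (r : ℝ), h w ≤ r → m ≤ L / 2 * ‖w - z‖ ^ 2 + r)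
    (hp : h p ≤ ((m - L / 2 * ‖p - z‖ ^ 2 : ℝ) : EReal)) {t : E} {s : ℝ} (ht : h t ≤ s) :
    m - L / 2 * ‖p - z‖ ^ 2 + L * ⟪z - p, t - p⟫ ≤ s := by
  have hseg : ∀ a : ℝ, 0 < a → a ≤ 1 →
      m - L / 2 * ‖p - z‖ ^ 2 + L * ⟪z - p, t - p⟫ ≤ s + a * (L / 2 * ‖t - p‖ ^ 2) := by
    intro a ha ha1
    have hmin := hm _ _ (hconv.le_coe hp ht (a := 1 - a) (b := a) (by linarith) ha.le (by ring))
    have hsub : (1 - a) • p + a • t - z = (p - z) + a • (t - p) := by module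
    have hneg : ⟪p - z, t - p⟫ = -⟪z - p, t - p⟫ := by
      rw [← inner_neg_left, neg_sub]
    rw [hsub, norm_add_sq_real, inner_smul_right, norm_smul, mul_pow, Real.norm_eq_abs, sq_abs,
      hneg] at hmin
    refine le_of_mul_le_mul_left ?_ ha
    linarith
  have hlim : Tendsto (fun a : ℝ => s + a * (L / 2 * ‖t - p‖ ^ 2)) (𝓝[>] 0) (𝓝 s) := by
    have hcont : Continuous fun a : ℝ => s + a * (L / 2 * ‖t - p‖ ^ 2) := by fun_prop
    simpa using (hcont.tendsto 0).mono_left nhdsWithin_le_nhds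
  refine ge_of_tendsto hlim ?_
  filter_upwards [Ioc_mem_nhdsGT (show (0 : ℝ) < 1 by norm_num)] with a ha
  exact hseg a ha.1 ha.2

omit [InnerProductSpace ℝ E] [CompleteSpace E] in
/-- An `ε`-optimal solution of the proximal problem of a proper function determines the finite
optimal value `m`. -/
lemma IsEpsOptimal.exists_value {L : ℝ} {h : E → EReal} {ε : ℝ} {z x : E}
    (hopt : IsEpsOptimal L h ε z x) (hproper : ∃ w, h w ≠ ⊤) (hnbot : ∀ w, h w ≠ ⊥) :
    ∃ m : ℝ, (⨅ w : E, proxObj L h z w) = m := by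
  have hcoe : ∀ w, proxObj L h z w ≠ ⊥ := fun w => by
    simpa only [proxObj, ne_eq, EReal.add_eq_bot_iff, EReal.coe_ne_bot, false_or] using hnbot w
  obtain ⟨w, hw⟩ := hproper
  have htop : (⨅ w : E, proxObj L h z w) ≠ ⊤ :=
    ((iInf_le _ w).trans_lt (EReal.add_lt_top (EReal.coe_ne_top _) hw)).ne
  have hbot : (⨅ w : E, proxObj L h z w) ≠ ⊥ := by
    intro hinf
    rw [IsEpsOptimal, hinf, EReal.add_bot] at hopt
    exact hcoe x (le_bot_iff.1 hopt)
  exact ⟨_, (EReal.coe_toReal htop hbot).symm⟩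

/-- An `ε`-optimal solution `x` of the proximal problem at `z` is within `√(2ε/L)` of the exact
minimizer `x + f`, and the subgradient `L • (z - (x + f))` there is an `ε`-subgradient at `x`. -/
lemma IsEpsOptimal.exists_epsSubgradient {L : ℝ} (hL : 0 < L) {h : E → EReal}
    (hconv : ERealConvexOn h) (hlsc : LowerSemicontinuous h) (hproper : ∃ w, h w ≠ ⊤)
    (hnbot : ∀ w, h w ≠ ⊥) {ε : ℝ} {z x : E} (hopt : IsEpsOptimal L h ε z x) :
    ∃ f : E, ‖f‖ ≤ Real.sqrt (2 * ε / L) ∧ L • (z - x - f) ∈ epsSubdiff h ε x := by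
  obtain ⟨m, hmeq⟩ := hopt.exists_value hproper hnbot
  have hm : ∀ (w : E) (r : ℝ), h w ≤ r → m ≤ L / 2 * ‖w - z‖ ^ 2 + r := by
    intro w r hw
    have hle : (m : EReal) ≤ proxObj L h z w := hmeq ▸ iInf_le _ w
    have hadd : proxObj L h z w ≤ ((L / 2 * ‖w - z‖ ^ 2 : ℝ) : EReal) + r := by
      unfold proxObj
      gcongr
    exact_mod_cast hle.trans hadd
  have happ : ∀ δ : ℝ, 0 < δ →
      ∃ (w : E) (r : ℝ), h w ≤ r ∧ L / 2 * ‖w - z‖ ^ 2 + r < m + δ := by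
    intro δ hδ
    have hlt : (⨅ w : E, proxObj L h z w) < ((m + δ : ℝ) : EReal) := by
      rw [hmeq]
      exact_mod_cast lt_add_of_pos_right m hδ
    obtain ⟨w, hw⟩ := iInf_lt_iff.1 hlt
    rw [proxObj] at hw
    have hwtop : h w ≠ ⊤ := by
      intro hw'
      rw [hw', EReal.coe_add_top] at hw
      exact not_top_lt hw
    lift h w to ℝ using ⟨hwtop, hnbot w⟩ with r hr
    exact ⟨w, r, hr.ge, by exact_mod_cast hw⟩
  obtain ⟨p, hp⟩ := exists_prox_minimizer hL hconv hlsc hm happ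
  rw [IsEpsOptimal, hmeq, proxObj] at hopt
  have hxtop : h x ≠ ⊤ := by
    intro hx
    rw [hx, EReal.coe_add_top, ← EReal.coe_add] at hopt
    exact EReal.coe_ne_top _ (top_le_iff.1 hopt)
  obtain ⟨c, hc⟩ : ∃ c : ℝ, h x = c := ⟨_, (EReal.coe_toReal hxtop (hnbot x)).symm⟩
  rw [hc] at hopt
  have hopt' : L / 2 * ‖x - z‖ ^ 2 + c ≤ ε + m := by exact_mod_cast hopt
  have hexp : ‖x - z‖ ^ 2 = ‖x - p‖ ^ 2 - 2 * ⟪z - p, x - p⟫ + ‖p - z‖ ^ 2 := by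
    rw [← sub_sub_sub_cancel_right x z p, norm_sub_sq_real, real_inner_comm, norm_sub_rev z p]
  have hgap : c + L / 2 * ‖x - p‖ ^ 2 ≤
      ε + (m - L / 2 * ‖p - z‖ ^ 2 + L * ⟪z - p, x - p⟫) := by
    rw [hexp] at hopt'
    linarith
  refine ⟨p - x, ?_, fun t => ?_⟩
  · have hx := prox_minimizer_subgradient hconv hm hp hc.le
    rw [norm_sub_rev]
    refine Real.le_sqrt_of_sq_le ?_
    rw [le_div_iff₀ hL]
    linarith
  · by_cases htop : h t = ⊤
    · simp [htop]
    obtain ⟨s, hs⟩ : ∃ s : ℝ, h t = s := ⟨_, (EReal.coe_toReal htop (hnbot t)).symm⟩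
    have ht := prox_minimizer_subgradient hconv hm hp hs.le
    rw [hc, hs, sub_sub_sub_cancel_right, real_inner_smul_left]
    have hsplit : ⟪z - p, t - p⟫ = ⟪z - p, t - x⟫ + ⟪z - p, x - p⟫ := by
      rw [← inner_add_right, sub_add_sub_cancel]
    rw [hsplit] at ht
    have hnn : 0 ≤ L / 2 * ‖x - p‖ ^ 2 := by positivity
    have hreal : c + L * ⟪z - p, t - x⟫ - ε ≤ s := by linarith
    exact_mod_cast hreal

theorem stmt_2
    (L : ℝ) (hL : 0 < L)
    (g : E → ℝ) (g' : E → E)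
    (hgconv : ConvexOn ℝ Set.univ g)
    (hgrad : ∀ w, HasGradientAt g (g' w) w)
    (hlip : ∀ w w', ‖g' w - g' w'‖ ≤ L * ‖w - w'‖)
    (h : E → EReal)
    (hhconv : ERealConvexOn h)
    (hhlsc : LowerSemicontinuous h)
    (hhproper : ∃ w, h w ≠ ⊤) (hhnbot : ∀ w, h w ≠ ⊥)
    (ε : ℝ) (hε : 0 ≤ ε) (z xx : E)
    (hopt : IsEpsOptimal L h ε z xx) :
    (∃ fvec : E, ‖fvec‖ ≤ Real.sqrt (2 * ε / L) ∧
      L • (z - xx - fvec) ∈ epsSubdiff h ε xx) ∧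
    (∀ y e : E, z = y - (1 / L) • (g' y + e) →
      ∃ fvec : E, ‖fvec‖ ≤ Real.sqrt (2 * ε / L) ∧
        L • (y - xx - (1 / L) • (g' y + e) - fvec) ∈ epsSubdiff h ε xx) := by
  have key := hopt.exists_epsSubgradient hL hhconv hhlsc hhproper hhnbot
  refine ⟨key, fun y e hz => ?_⟩
  rwa [hz, sub_right_comm] at key
end
end

section
/- Let x_prev, x, e, f_vec ∈ E and ε ≥ 0 satisfy ‖f_vec‖ ≤ √(2ε/L) and L( x_prev − x − (1/L)(g'(x_prev) + e) − f_vec ) ∈ ∂_ε h(x). Then f(x) ≤ f(x*) − (L/2)‖x − x*‖² + (L/2)‖x_prev − x*‖² + ε + (‖e‖ + √(2Lε)) · ‖x − x*‖. -/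
open scoped RealInnerProductSpace
open Finset

noncomputable section

variable {E : Type*} [NormedAddCommGroup E] [InnerProductSpace ℝ E] [CompleteSpace E]

/-- The derivative of a differentiable function along a line. -/
lemma HasGradientAt.hasDerivAt_line {g : E → ℝ} {g' p v : E} {t : ℝ}
    (hg : HasGradientAt g g' (p + t • v)) :
    HasDerivAt (fun s : ℝ => g (p + s • v)) ⟪g', v⟫ t := by
  have hline : HasDerivAt (fun s : ℝ => p + s • v) v t := by
    simpa using ((hasDerivAt_id t).smul_const v).const_add p
  exact hg.hasFDerivAt.comp_hasDerivAt t hline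

/-- First-order characterization of convexity: the graph lies above its tangents. -/
lemma ConvexOn.add_inner_gradient_le {g : E → ℝ} {g' p : E} (hconv : ConvexOn ℝ Set.univ g)
    (hg : HasGradientAt g g' p) (s : E) : g p + ⟪g', s - p⟫ ≤ g s := by
  have hline : ConvexOn ℝ Set.univ (fun t : ℝ => g (p + t • (s - p))) := by
    have := hconv.comp_affineMap (AffineMap.lineMap p s : ℝ →ᵃ[ℝ] E)
    simpa [Function.comp_def, AffineMap.lineMap_apply, add_comm] using this
  have hderiv : HasDerivAt (fun t : ℝ => g (p + t • (s - p))) ⟪g', s - p⟫ 0 :=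
    HasGradientAt.hasDerivAt_line (by simpa using hg)
  have hslope := hline.le_slope_of_hasDerivAt (Set.mem_univ 0) (Set.mem_univ 1) one_pos hderiv
  simp only [slope_def_field, one_smul, zero_smul, add_zero, sub_zero, div_one,
    add_sub_cancel] at hslope
  linarith

/-- The descent lemma for functions with Lipschitz gradient. -/
lemma le_add_inner_gradient_add_sq {g : E → ℝ} {g' : E → E} {L : ℝ}
    (hgrad : ∀ w, HasGradientAt g (g' w) w) (hlip : ∀ w w', ‖g' w - g' w'‖ ≤ L * ‖w - w'‖)
    (p x : E) : g x ≤ g p + ⟪g' p, x - p⟫ + L / 2 * ‖x - p‖ ^ 2 := by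
  set v := x - p with hv
  have hderiv (t : ℝ) : HasDerivAt (fun s : ℝ => g (p + s • v)) ⟪g' (p + t • v), v⟫ t :=
    (hgrad _).hasDerivAt_line
  have hbound (t : ℝ) : HasDerivAt
      (fun s : ℝ => g p + s * ⟪g' p, v⟫ + L / 2 * ‖v‖ ^ 2 * s ^ 2)
      (⟪g' p, v⟫ + L * t * ‖v‖ ^ 2) t := by
    refine ((((hasDerivAt_id t).mul_const ⟪g' p, v⟫).const_add (g p)).add
      ((hasDerivAt_pow 2 t).const_mul (L / 2 * ‖v‖ ^ 2))).congr_deriv ?_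
    push_cast
    ring
  have key := image_le_of_deriv_right_le_deriv_boundary (a := (0 : ℝ)) (b := 1)
    (fun t _ => (hderiv t).continuousAt.continuousWithinAt)
    (fun t _ => (hderiv t).hasDerivWithinAt) (by simp)
    (fun t _ => (hbound t).continuousAt.continuousWithinAt)
    (fun t _ => (hbound t).hasDerivWithinAt)
    (fun t ht => by
      have hinner : ⟪g' (p + t • v) - g' p, v⟫ ≤ L * t * ‖v‖ ^ 2 :=
        calc ⟪g' (p + t • v) - g' p, v⟫ ≤ ‖g' (p + t • v) - g' p‖ * ‖v‖ :=
              real_inner_le_norm _ _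
          _ ≤ L * ‖p + t • v - p‖ * ‖v‖ := by gcongr; exact hlip _ _
          _ = L * t * ‖v‖ ^ 2 := by
              rw [add_sub_cancel_left, norm_smul, Real.norm_of_nonneg ht.1]
              ring
      rw [inner_sub_left] at hinner
      linarith)
    (Set.right_mem_Icc.2 zero_le_one)
  simpa [hv] using key

/-- The real inequality behind one inexact proximal-gradient step: the value `a` of the nonsmooth
part at `x` is compared with its value `b` at `s` through an `ε`-subgradient inequality. -/
lemma proximal_gradient_step_le {g : E → ℝ} {g' : E → E} {L : ℝ} (hL : 0 < L)
    (hgconv : ConvexOn ℝ Set.univ g) (hgrad : ∀ w, HasGradientAt g (g' w) w)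
    (hlip : ∀ w w', ‖g' w - g' w'‖ ≤ L * ‖w - w'‖) {p x s e v : E} {ε a b : ℝ}
    (hv : ‖v‖ ≤ √(2 * ε / L))
    (hsub : a + ⟪L • (p - x - (1 / L) • (g' p + e) - v), s - x⟫ - ε ≤ b) :
    g x + a ≤ g s + b + (-(L / 2) * ‖x - s‖ ^ 2 + L / 2 * ‖p - s‖ ^ 2 + ε +
      (‖e‖ + √(2 * L * ε)) * ‖x - s‖) := by
  have hdescent := le_add_inner_gradient_add_sq hgrad hlip p x
  have htangent := hgconv.add_inner_gradient_le (hgrad p) s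
  have hLv : L * ‖v‖ ≤ √(2 * L * ε) :=
    calc L * ‖v‖ ≤ L * √(2 * ε / L) := by gcongr
      _ = √(L ^ 2 * (2 * ε / L)) := by
          rw [Real.sqrt_mul (sq_nonneg L), Real.sqrt_sq hL.le]
      _ = √(2 * L * ε) := by
          congr 1
          field_simp
  have he : ⟪e, s - x⟫ ≤ ‖e‖ * ‖x - s‖ := by
    simpa [norm_sub_rev] using real_inner_le_norm e (s - x)
  have hvs : L * ⟪v, s - x⟫ ≤ √(2 * L * ε) * ‖x - s‖ :=
    calc L * ⟪v, s - x⟫ ≤ L * (‖v‖ * ‖s - x‖) := by gcongr; exact real_inner_le_norm _ _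
      _ = L * ‖v‖ * ‖x - s‖ := by rw [norm_sub_rev s x]; ring
      _ ≤ √(2 * L * ε) * ‖x - s‖ := by gcongr
  have hexpand : ⟪L • (p - x - (1 / L) • (g' p + e) - v), s - x⟫ =
      L * ⟪p - x, s - x⟫ - ⟪g' p, s - x⟫ - ⟪e, s - x⟫ - L * ⟪v, s - x⟫ := by
    simp only [inner_smul_left, inner_sub_left, inner_add_left, conj_trivial]
    field_simp
    ring
  have hsplit : ⟪g' p, s - x⟫ = ⟪g' p, s - p⟫ - ⟪g' p, x - p⟫ := by
    rw [← inner_sub_right, sub_sub_sub_cancel_right]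
  have hpolar : ‖p - s‖ ^ 2 = ‖x - p‖ ^ 2 - 2 * ⟪p - x, s - x⟫ + ‖x - s‖ ^ 2 := by
    rw [norm_sub_rev x p, norm_sub_rev x s, ← norm_sub_sq_real, sub_sub_sub_cancel_right]
  rw [hexpand] at hsub
  rw [hpolar]
  linarith

omit [CompleteSpace E] in
/-- An `ε`-subdifferentiable point of a proper function lies in its effective domain. -/
lemma ne_top_of_mem_epsSubdiff {a : E → EReal} {ε : ℝ} {x y : E} (hproper : ∃ w, a w ≠ ⊤)
    (hy : y ∈ epsSubdiff a ε x) : a x ≠ ⊤ := by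
  obtain ⟨w, hw⟩ := hproper
  intro hx
  have hyw := hy w
  rw [hx, EReal.top_add_coe, EReal.top_sub_coe, top_le_iff] at hyw
  exact hw hyw

theorem stmt_3
    (L : ℝ) (hL : 0 < L)
    (g : E → ℝ) (g' : E → E)
    (hgconv : ConvexOn ℝ Set.univ g)
    (hgrad : ∀ w, HasGradientAt g (g' w) w)
    (hlip : ∀ w w', ‖g' w - g' w'‖ ≤ L * ‖w - w'‖)
    (h : E → EReal)
    (hhconv : ERealConvexOn h)
    (hhlsc : LowerSemicontinuous h)
    (hhproper : ∃ w, h w ≠ ⊤) (hhnbot : ∀ w, h w ≠ ⊥)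
    (f : E → EReal) (hf : ∀ w, f w = ((g w : ℝ) : EReal) + h w)
    (xstar : E) (hmin : ∀ w, f xstar ≤ f w)
    (xprev xx e fvec : E) (ε : ℝ) (hε : 0 ≤ ε)
    (hfvec : ‖fvec‖ ≤ Real.sqrt (2 * ε / L))
    (hsub : L • (xprev - xx - (1 / L) • (g' xprev + e) - fvec) ∈ epsSubdiff h ε xx) :
    f xx ≤ f xstar + ((-(L / 2) * ‖xx - xstar‖ ^ 2 + L / 2 * ‖xprev - xstar‖ ^ 2 + ε +
      (‖e‖ + Real.sqrt (2 * L * ε)) * ‖xx - xstar‖ : ℝ) : EReal) := by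
  have hx_top := ne_top_of_mem_epsSubdiff hhproper hsub
  rw [hf, hf]
  have hsubstar := hsub xstar
  by_cases hs_top : h xstar = ⊤
  · rw [hs_top, EReal.coe_add_top, EReal.top_add_coe]
    exact le_top
  lift h xx to ℝ using ⟨hx_top, hhnbot xx⟩ with a
  lift h xstar to ℝ using ⟨hs_top, hhnbot xstar⟩ with b
  norm_cast at hsubstar ⊢
  exact proximal_gradient_step_le hL hgconv hgrad hlip hfvec hsubstar
end
end

section
/- Consider the basic inexact proximal-gradient method (y_k = x_k): for each k ≥ 1, x_k is an ε_k-optimal solution of the proximal problem at x_{k-1} − (1/L)(g'(x_{k-1}) + e_k). Define A_k = Σ_{i=1}^k ( ‖e_i‖/L + √(2ε_i/L) ) and B_k = Σ_{i=1}^k ε_i/L. Then for all k ≥ 1, ‖x_k − x*‖ ≤ A_k + ( ‖x_0 − x*‖² + 2B_k + A_k² )^{1/2}; in particular ‖x_i − x*‖ ≤ ‖x_0 − x*‖ + 2A_k + √(2B_k) for all 1 ≤ i ≤ k. -/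
open scoped RealInnerProductSpace
open Finset

noncomputable section

variable {E : Type*} [NormedAddCommGroup E] [InnerProductSpace ℝ E] [CompleteSpace E]

theorem hasDerivAt_comp_line {g : E → ℝ} {g' : E → E} (hgrad : ∀ w, HasGradientAt g (g' w) w)
    (a v : E) (t : ℝ) :
    HasDerivAt (fun s : ℝ => g (a + s • v)) ⟪g' (a + t • v), v⟫ t := by
  have hline : HasDerivAt (fun s : ℝ => a + s • v) v t := by
    simpa using ((hasDerivAt_id t).smul_const v).const_add a
  exact (hgrad (a + t • v)).hasFDerivAt.comp_hasDerivAt t hline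

/-- The descent lemma. -/
theorem le_add_inner_add_sq_of_lipschitz_gradient {L : ℝ} {g : E → ℝ} {g' : E → E}
    (hgrad : ∀ w, HasGradientAt g (g' w) w)
    (hlip : ∀ w w', ‖g' w - g' w'‖ ≤ L * ‖w - w'‖) (a v : E) :
    g (a + v) ≤ g a + ⟪g' a, v⟫ + L / 2 * ‖v‖ ^ 2 := by
  have hderiv (t : ℝ) : HasDerivAt
      (fun s : ℝ => g (a + s • v) - s * ⟪g' a, v⟫ - L / 2 * ‖v‖ ^ 2 * s ^ 2)
      (⟪g' (a + t • v), v⟫ - ⟪g' a, v⟫ - L * ‖v‖ ^ 2 * t) t := by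
    refine (((hasDerivAt_comp_line hgrad a v t).sub
      ((hasDerivAt_id t).mul_const ⟪g' a, v⟫)).sub
      ((hasDerivAt_pow 2 t).const_mul (L / 2 * ‖v‖ ^ 2))).congr_deriv ?_
    norm_num
    ring
  have hanti : AntitoneOn
      (fun s : ℝ => g (a + s • v) - s * ⟪g' a, v⟫ - L / 2 * ‖v‖ ^ 2 * s ^ 2) (Set.Icc 0 1) := by
    refine antitoneOn_of_deriv_nonpos (convex_Icc 0 1)
      (fun t _ => (hderiv t).continuousAt.continuousWithinAt)
      (fun t _ => (hderiv t).differentiableAt.differentiableWithinAt) fun t ht => ?_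
    rw [interior_Icc] at ht
    rw [(hderiv t).deriv, ← inner_sub_left]
    have hnorm : ‖g' (a + t • v) - g' a‖ ≤ L * (t * ‖v‖) := by
      simpa [norm_smul, abs_of_pos ht.1] using hlip (a + t • v) a
    nlinarith [real_inner_le_norm (g' (a + t • v) - g' a) v,
      mul_le_mul_of_nonneg_right hnorm (norm_nonneg v)]
  have h01 := hanti (Set.left_mem_Icc.2 zero_le_one) (Set.right_mem_Icc.2 zero_le_one) zero_le_one
  simp only [one_smul, zero_smul, add_zero] at h01
  linarith

theorem add_inner_le_of_convexOn_gradient {g : E → ℝ} {g' : E → E}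
    (hgconv : ConvexOn ℝ Set.univ g) (hgrad : ∀ w, HasGradientAt g (g' w) w) (a v : E) :
    g a + ⟪g' a, v⟫ ≤ g (a + v) := by
  have hconv : ConvexOn ℝ Set.univ (fun s : ℝ => g (a + s • v)) := by
    refine ⟨convex_univ, fun s _ t _ p q hp hq hpq => ?_⟩
    have hpoint : a + (p • s + q • t) • v = p • (a + s • v) + q • (a + t • v) := by
      calc a + (p • s + q • t) • v = (p + q) • a + (p • s + q • t) • v := by rw [hpq, one_smul]
        _ = _ := by simp only [smul_eq_mul]; module
    dsimp only
    rw [hpoint]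
    exact hgconv.2 (Set.mem_univ _) (Set.mem_univ _) hp hq hpq
  have hslope := hconv.le_slope_of_hasDerivAt (Set.mem_univ (0 : ℝ)) (Set.mem_univ 1) zero_lt_one
    (hasDerivAt_comp_line hgrad a v 0)
  simp only [slope_def_field, zero_smul, add_zero, one_smul, sub_zero, div_one] at hslope
  linarith

theorem add_inner_add_sq_le_of_lipschitz_gradient {L : ℝ} (hL : 0 < L) {g : E → ℝ} {g' : E → E}
    (hgconv : ConvexOn ℝ Set.univ g) (hgrad : ∀ w, HasGradientAt g (g' w) w)
    (hlip : ∀ w w', ‖g' w - g' w'‖ ≤ L * ‖w - w'‖) (a b : E) :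
    g a + ⟪g' a, b - a⟫ + 1 / (2 * L) * ‖g' b - g' a‖ ^ 2 ≤ g b := by
  have hlow := add_inner_le_of_convexOn_gradient hgconv hgrad a
    ((b - a) + (-(1 / L)) • (g' b - g' a))
  have hup := le_add_inner_add_sq_of_lipschitz_gradient hgrad hlip b
    ((-(1 / L)) • (g' b - g' a))
  rw [← add_assoc, add_sub_cancel, inner_add_right, inner_smul_right] at hlow
  rw [inner_smul_right, norm_smul, mul_pow, Real.norm_eq_abs, sq_abs] at hup
  have hsq : ⟪g' b, g' b - g' a⟫ - ⟪g' a, g' b - g' a⟫ = ‖g' b - g' a‖ ^ 2 := by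
    rw [← inner_sub_left, real_inner_self_eq_norm_sq]
  have hcoef : L / 2 * ((-(1 / L)) ^ 2 * ‖g' b - g' a‖ ^ 2)
      = 1 / L * ‖g' b - g' a‖ ^ 2 - 1 / (2 * L) * ‖g' b - g' a‖ ^ 2 := by
    field_simp
    ring
  linear_combination hlow + hup + hcoef - 1 / L * hsq

/-- A gradient step of length `1 / L` on a convex function with `L`-Lipschitz gradient is
nonexpansive. -/
theorem norm_gradient_step_sub_le {L : ℝ} (hL : 0 < L) {g : E → ℝ} {g' : E → E}
    (hgconv : ConvexOn ℝ Set.univ g) (hgrad : ∀ w, HasGradientAt g (g' w) w)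
    (hlip : ∀ w w', ‖g' w - g' w'‖ ≤ L * ‖w - w'‖) (a b : E) :
    ‖(a - (1 / L) • g' a) - (b - (1 / L) • g' b)‖ ≤ ‖a - b‖ := by
  have hab := add_inner_add_sq_le_of_lipschitz_gradient hL hgconv hgrad hlip a b
  have hba := add_inner_add_sq_le_of_lipschitz_gradient hL hgconv hgrad hlip b a
  have hinner : ⟪g' a, b - a⟫ + ⟪g' b, a - b⟫ = -⟪a - b, g' a - g' b⟫ := by
    rw [real_inner_comm (g' a - g' b), inner_sub_left, ← neg_sub a b, inner_neg_right]
    ring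
  have hcoco : 1 / L * ‖g' a - g' b‖ ^ 2 ≤ ⟪a - b, g' a - g' b⟫ := by
    rw [norm_sub_rev (g' b)] at hab
    have hcoef : 1 / (2 * L) = 1 / L / 2 := by field_simp
    rw [hcoef] at hab hba
    linarith
  refine (sq_le_sq₀ (norm_nonneg _) (norm_nonneg _)).1 ?_
  have hrw : (a - (1 / L) • g' a) - (b - (1 / L) • g' b)
      = (a - b) - (1 / L) • (g' a - g' b) := by module
  rw [hrw, norm_sub_sq_real, inner_smul_right, norm_smul, mul_pow, Real.norm_eq_abs, sq_abs]
  have hmul := mul_le_mul_of_nonneg_left hcoco (one_div_pos.2 hL).le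
  have hnn : 0 ≤ 1 / L * (1 / L * ‖g' a - g' b‖ ^ 2) := by positivity
  nlinarith

theorem ERealConvexOn.le_coe_s4 {h : E → EReal} (hh : ERealConvexOn h) {p q : E} {c d : ℝ}
    (hp : h p = c) (hq : h q = d) {t : ℝ} (ht0 : 0 ≤ t) (ht1 : t ≤ 1) :
    h (p + t • (q - p)) ≤ (((1 - t) * c + t * d : ℝ) : EReal) := by
  have hcomb := hh p q (1 - t) t (sub_nonneg.2 ht1) ht0 (sub_add_cancel 1 t)
  rw [hp, hq, show (1 - t) • p + t • q = p + t • (q - p) by module] at hcomb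
  exact_mod_cast hcomb

theorem IsEpsOptimal.le_coe_s4 {L ε : ℝ} {h : E → EReal} {y p z : E} {c d : ℝ}
    (hopt : IsEpsOptimal L h ε y p) (hp : h p = c) (hz : h z ≤ d) :
    L / 2 * ‖p - y‖ ^ 2 + c ≤ ε + (L / 2 * ‖z - y‖ ^ 2 + d) := by
  have hle : proxObj L h y p ≤ (ε : EReal) + (((L / 2 * ‖z - y‖ ^ 2 : ℝ) : EReal) + d) :=
    hopt.trans (add_le_add le_rfl ((iInf_le _ z).trans (add_le_add le_rfl hz)))
  rw [proxObj, hp] at hle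
  exact_mod_cast hle

theorem IsEpsOptimal.ne_top {L ε : ℝ} {h : E → EReal} {y p z : E}
    (hopt : IsEpsOptimal L h ε y p) (hz : h z ≠ ⊤) : h p ≠ ⊤ := by
  intro hp
  have hle : proxObj L h y p ≤ (ε : EReal) + proxObj L h y z :=
    hopt.trans (add_le_add le_rfl (iInf_le _ z))
  rw [proxObj, hp, EReal.coe_add_top, top_le_iff] at hle
  exact EReal.add_ne_top (EReal.coe_ne_top _) (EReal.add_ne_top (EReal.coe_ne_top _) hz) hle

/-- First-order optimality: at a minimizer `p` of `g + h`, `-g' p` is a subgradient of `h`. -/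
theorem le_add_inner_of_isMin {L : ℝ} (hL : 0 < L) {g : E → ℝ} {g' : E → E}
    (hgrad : ∀ w, HasGradientAt g (g' w) w)
    (hlip : ∀ w w', ‖g' w - g' w'‖ ≤ L * ‖w - w'‖)
    {h : E → EReal} (hh : ERealConvexOn h) {p q : E} {c d : ℝ}
    (hmin : ∀ w, (g p : EReal) + h p ≤ (g w : EReal) + h w) (hp : h p = c) (hq : h q = d) :
    c ≤ d + ⟪g' p, q - p⟫ := by
  have hquad {t : ℝ} (ht0 : 0 ≤ t) (ht1 : t ≤ 1) :
      t * (c - d - ⟪g' p, q - p⟫) ≤ t * (t * (L / 2 * ‖q - p‖ ^ 2)) := by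
    have hle := (hmin (p + t • (q - p))).trans (add_le_add le_rfl (hh.le_coe_s4 hp hq ht0 ht1))
    rw [hp] at hle
    have hreal : g p + c ≤ g (p + t • (q - p)) + ((1 - t) * c + t * d) := by exact_mod_cast hle
    have hup := le_add_inner_add_sq_of_lipschitz_gradient hgrad hlip p (t • (q - p))
    rw [inner_smul_right, norm_smul, mul_pow, Real.norm_eq_abs, sq_abs] at hup
    linarith
  by_contra! hlt
  set m := c - d - ⟪g' p, q - p⟫ with hm
  set K := L / 2 * ‖q - p‖ ^ 2 with hK
  have hmpos : 0 < m := by linarith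
  have hKnn : 0 ≤ K := by positivity
  have htpos : 0 < m / (m + K) := by positivity
  have hlem : m ≤ m / (m + K) * K :=
    le_of_mul_le_mul_left (hquad htpos.le (div_le_one_of_le₀ (by linarith) (by linarith))) htpos
  rw [div_mul_eq_mul_div, le_div_iff₀ (by linarith)] at hlem
  nlinarith

/-- An `ε`-optimal solution of the proximal problem at `y` is within `‖y - (q - (1 / L) • u)‖`
plus `√(2ε / L)` of `q` whenever `-u` is a subgradient of `h` at `q`. -/
theorem IsEpsOptimal.norm_sub_le {L ε : ℝ} (hL : 0 < L) {h : E → EReal} (hh : ERealConvexOn h)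
    {y p q u : E} {c d : ℝ} (hopt : IsEpsOptimal L h ε y p) (hp : h p = c) (hq : h q = d)
    (hsub : d ≤ c + ⟪u, p - q⟫) :
    ‖p - q‖ ≤ ‖y - (q - (1 / L) • u)‖ + √(2 * ε / L) := by
  set D := ‖y - (q - (1 / L) • u)‖ with hD
  rcases le_or_gt ‖p - q‖ D with hle | hlt
  · exact hle.trans (le_add_of_nonneg_right (Real.sqrt_nonneg _))
  have hDnn : 0 ≤ D := norm_nonneg _
  have hpos : 0 < ‖p - q‖ := hDnn.trans_lt hlt
  set t := (‖p - q‖ - D) / ‖p - q‖ with ht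
  have ht0 : 0 ≤ t := div_nonneg (by linarith) hpos.le
  have ht1 : t ≤ 1 := div_le_one_of_le₀ (by linarith) hpos.le
  have htd : t * ‖p - q‖ = ‖p - q‖ - D := div_mul_cancel₀ _ hpos.ne'
  have hcmp := hopt.le_coe_s4 hp (hh.le_coe_s4 hp hq ht0 ht1)
  have hexpand : ‖p + t • (q - p) - y‖ ^ 2
      = ‖p - y‖ ^ 2 - 2 * (t * ⟪p - y, p - q⟫) + t ^ 2 * ‖p - q‖ ^ 2 := by
    rw [show p + t • (q - p) - y = (p - y) - t • (p - q) by module, norm_sub_sq_real,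
      inner_smul_right, norm_smul, mul_pow, Real.norm_eq_abs, sq_abs]
  have hinner : L * ⟪p - y, p - q⟫ + L * ⟪y - (q - (1 / L) • u), p - q⟫
      = L * ‖p - q‖ ^ 2 + ⟪u, p - q⟫ := by
    rw [← mul_add, ← inner_add_left,
      show p - y + (y - (q - (1 / L) • u)) = (p - q) + (1 / L) • u by module,
      inner_add_left, real_inner_smul_left, real_inner_self_eq_norm_sq]
    field_simp
  have hcs : ⟪y - (q - (1 / L) • u), p - q⟫ ≤ D * ‖p - q‖ := real_inner_le_norm _ _
  rw [hexpand] at hcmp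
  have hkey : L / 2 * (‖p - q‖ - D) ^ 2 ≤ ε := by
    have h1 : t * (L * ‖p - q‖ ^ 2 + ⟪u, p - q⟫ - L * (D * ‖p - q‖))
        ≤ t * (L * ⟪p - y, p - q⟫) :=
      mul_le_mul_of_nonneg_left (by nlinarith) ht0
    have h2 := mul_le_mul_of_nonneg_left hsub ht0
    have h3 : t * (L * ‖p - q‖ ^ 2 - L * (D * ‖p - q‖)) - L / 2 * (t ^ 2 * ‖p - q‖ ^ 2)
        = L / 2 * (‖p - q‖ - D) ^ 2 := by
      linear_combination (L * (‖p - q‖ - D) - L / 2 * (t * ‖p - q‖ + (‖p - q‖ - D))) * htd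
    linarith
  have hsqrt : ‖p - q‖ - D ≤ √(2 * ε / L) := by
    apply Real.le_sqrt_of_sq_le
    rw [le_div_iff₀ hL]
    linarith
  linarith

theorem stmt_4
    (L : ℝ) (hL : 0 < L)
    (g : E → ℝ) (g' : E → E)
    (hgconv : ConvexOn ℝ Set.univ g)
    (hgrad : ∀ w, HasGradientAt g (g' w) w)
    (hlip : ∀ w w', ‖g' w - g' w'‖ ≤ L * ‖w - w'‖)
    (h : E → EReal)
    (hhconv : ERealConvexOn h)
    (hhlsc : LowerSemicontinuous h)
    (hhproper : ∃ w, h w ≠ ⊤) (hhnbot : ∀ w, h w ≠ ⊥)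
    (f : E → EReal) (hf : ∀ w, f w = ((g w : ℝ) : EReal) + h w)
    (xstar : E) (hmin : ∀ w, f xstar ≤ f w)
    (x e : ℕ → E) (ε : ℕ → ℝ) (hεnn : ∀ k, 0 ≤ ε k)
    (hstep : ∀ k, 1 ≤ k →
      IsEpsOptimal L h (ε k) (x (k - 1) - (1 / L) • (g' (x (k - 1)) + e k)) (x k))
    (A B : ℕ → ℝ)
    (hA : ∀ k, A k = ∑ i ∈ Icc 1 k, (‖e i‖ / L + Real.sqrt (2 * ε i / L)))
    (hB : ∀ k, B k = ∑ i ∈ Icc 1 k, ε i / L)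
    :
    ∀ k, 1 ≤ k →
      ‖x k - xstar‖ ≤ A k + Real.sqrt (‖x 0 - xstar‖ ^ 2 + 2 * B k + A k ^ 2) ∧
      ∀ i, 1 ≤ i → i ≤ k →
        ‖x i - xstar‖ ≤ ‖x 0 - xstar‖ + 2 * A k + Real.sqrt (2 * B k) := by
  obtain ⟨w, hw⟩ := hhproper
  have hmin' : ∀ z, (g xstar : EReal) + h xstar ≤ (g z : EReal) + h z := fun z => by
    simpa only [hf] using hmin z
  have htop : h xstar ≠ ⊤ := by
    intro hx
    have hle := hmin' w
    rw [hx, EReal.coe_add_top, top_le_iff] at hle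
    exact EReal.add_ne_top (EReal.coe_ne_top _) hw hle
  have hxstar := (EReal.coe_toReal htop (hhnbot xstar)).symm
  have hrec (k : ℕ) : ‖x (k + 1) - xstar‖
      ≤ ‖x k - xstar‖ + (‖e (k + 1)‖ / L + √(2 * ε (k + 1) / L)) := by
    have hopt := hstep (k + 1) (Nat.succ_pos k)
    rw [Nat.add_sub_cancel] at hopt
    have hxk := (EReal.coe_toReal (hopt.ne_top hw) (hhnbot _)).symm
    have hprox := hopt.norm_sub_le hL hhconv hxk hxstar
      (le_add_inner_of_isMin hL hgrad hlip hhconv hmin' hxstar hxk)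
    have hsplit : x k - (1 / L) • (g' (x k) + e (k + 1)) - (xstar - (1 / L) • g' xstar)
        = ((x k - (1 / L) • g' (x k)) - (xstar - (1 / L) • g' xstar))
          - (1 / L) • e (k + 1) := by module
    have herr : ‖(1 / L) • e (k + 1)‖ = ‖e (k + 1)‖ / L := by
      rw [norm_smul, Real.norm_of_nonneg (one_div_pos.2 hL).le, one_div_mul_eq_div]
    rw [hsplit] at hprox
    have htri := norm_sub_le ((x k - (1 / L) • g' (x k)) - (xstar - (1 / L) • g' xstar))
      ((1 / L) • e (k + 1))
    linarith [norm_gradient_step_sub_le hL hgconv hgrad hlip (x k) xstar]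
  have hAsucc (k : ℕ) : A (k + 1) = A k + (‖e (k + 1)‖ / L + √(2 * ε (k + 1) / L)) := by
    rw [hA, hA, sum_Icc_succ_top (Nat.succ_pos k)]
  have hAmono : Monotone A := monotone_nat_of_le_succ fun k => by
    rw [hAsucc]
    exact le_add_of_nonneg_right (by positivity)
  have hA0 : A 0 = 0 := by simp [hA]
  have hdist (k : ℕ) : ‖x k - xstar‖ ≤ ‖x 0 - xstar‖ + A k := by
    induction k with
    | zero => simp [hA0]
    | succ k ih => linarith [hrec k, hAsucc k]
  intro k _
  have hBnn : 0 ≤ B k := by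
    rw [hB]
    exact sum_nonneg fun i _ => div_nonneg (hεnn i) hL.le
  constructor
  · have hsqrt : ‖x 0 - xstar‖ ≤ √(‖x 0 - xstar‖ ^ 2 + 2 * B k + A k ^ 2) :=
      Real.le_sqrt_of_sq_le (by nlinarith [sq_nonneg (A k)])
    linarith [hdist k]
  · intro i _ hik
    linarith [hdist i, hAmono hik, hA0 ▸ hAmono (Nat.zero_le k), Real.sqrt_nonneg (2 * B k)]
end
end

section
/- Let g : E → ℝ be μ-strongly convex and differentiable with gradient g' Lipschitz continuous with constant L, where 0 < μ ≤ L. Then for all x, y ∈ E, ‖ x − y − (1/L)(g'(x) − g'(y)) ‖ ≤ (1 − μ/L) ‖x − y‖. -/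
open scoped RealInnerProductSpace
open Finset

noncomputable section

variable {E : Type*} [NormedAddCommGroup E] [InnerProductSpace ℝ E] [CompleteSpace E]

/-- A function trapped between its tangent planes and their quadratic perturbations of curvature `M`
has an `M`-Lipschitz gradient. -/
theorem norm_sub_le_of_tangent_bounds {F : Type*} [NormedAddCommGroup F] [InnerProductSpace ℝ F]
    {M : ℝ} {f : F → ℝ} {f' : F → F}
    (hlower : ∀ x y, f x + ⟪f' x, y - x⟫ ≤ f y)
    (hupper : ∀ x y, f y ≤ f x + ⟪f' x, y - x⟫ + M / 2 * ‖y - x‖ ^ 2) (x y : F) :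
    ‖f' x - f' y‖ ≤ M * ‖x - y‖ := by
  have step : ∀ (s : ℝ) (x y : F), f x + ⟪f' x, y - x⟫ + s * ‖f' x - f' y‖ ^ 2
      - M / 2 * s ^ 2 * ‖f' x - f' y‖ ^ 2 ≤ f y := by
    intro s x y
    have h1 := hlower x (y + s • (f' x - f' y))
    have h2 := hupper y (y + s • (f' x - f' y))
    rw [add_sub_right_comm, inner_add_right, inner_smul_right] at h1
    rw [add_sub_cancel_left, inner_smul_right, norm_smul, mul_pow, Real.norm_eq_abs, sq_abs] at h2
    have h3 : ⟪f' x, f' x - f' y⟫ - ⟪f' y, f' x - f' y⟫ = ‖f' x - f' y‖ ^ 2 := by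
      rw [← inner_sub_left, real_inner_self_eq_norm_sq]
    linear_combination h1 + h2 - s * h3
  rcases eq_or_ne x y with rfl | hxy
  · simp
  have hb : 0 < ‖x - y‖ := norm_pos_iff.2 (sub_ne_zero.2 hxy)
  have key : ∀ s : ℝ, (2 * s - M * s ^ 2) * ‖f' x - f' y‖ ^ 2 ≤ ‖f' x - f' y‖ * ‖x - y‖ := by
    intro s
    have h1 := step s x y
    have h2 := step s y x
    have h3 := real_inner_le_norm (f' x - f' y) (x - y)
    rw [inner_sub_left] at h3
    rw [← neg_sub x y, inner_neg_right] at h1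
    rw [norm_sub_rev (f' y)] at h2
    linear_combination h1 + h2 + h3
  rcases (norm_nonneg (f' x - f' y)).eq_or_lt with ha | ha
  · have h := (hlower x y).trans (hupper x y)
    have hM : 0 ≤ M / 2 * ‖y - x‖ ^ 2 := by linarith
    rw [norm_sub_rev] at hM
    rw [← ha]
    have hM' : 0 ≤ M := by
      by_contra! hneg
      nlinarith [pow_pos hb 2]
    positivity
  · have h := key (‖x - y‖ / ‖f' x - f' y‖)
    have e : (2 * (‖x - y‖ / ‖f' x - f' y‖) - M * (‖x - y‖ / ‖f' x - f' y‖) ^ 2)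
        * ‖f' x - f' y‖ ^ 2 = 2 * (‖f' x - f' y‖ * ‖x - y‖) - M * ‖x - y‖ ^ 2 := by
      field_simp
    rw [e] at h
    refine le_of_mul_le_mul_right ?_ hb
    linarith

/-- The descent lemma: the quadratic upper bound for a function with Lipschitz gradient. -/
theorem le_tangent_add_of_lipschitz_gradient {F : Type*} [NormedAddCommGroup F]
    [InnerProductSpace ℝ F] [CompleteSpace F] {L : ℝ} {g : F → ℝ} {g' : F → F}
    (hgrad : ∀ w, HasGradientAt g (g' w) w)
    (hlip : ∀ w w', ‖g' w - g' w'‖ ≤ L * ‖w - w'‖) (x y : F) :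
    g y ≤ g x + ⟪g' x, y - x⟫ + L / 2 * ‖y - x‖ ^ 2 := by
  have hderiv : ∀ t : ℝ, HasDerivAt
      (fun t : ℝ ↦ g (x + t • (y - x)) - t * ⟪g' x, y - x⟫ - L / 2 * ‖y - x‖ ^ 2 * t ^ 2)
      (⟪g' (x + t • (y - x)), y - x⟫ - ⟪g' x, y - x⟫ - L * ‖y - x‖ ^ 2 * t) t := by
    intro t
    have hline : HasDerivAt (fun t : ℝ ↦ x + t • (y - x)) (y - x) t := by
      simpa using ((hasDerivAt_id t).smul_const (y - x)).const_add x
    have hcomp := (hgrad (x + t • (y - x))).hasFDerivAt.comp_hasDerivAt t hline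
    rw [InnerProductSpace.toDual_apply_apply] at hcomp
    refine ((hcomp.sub ((hasDerivAt_id t).mul_const ⟪g' x, y - x⟫)).sub
      ((hasDerivAt_pow 2 t).const_mul (L / 2 * ‖y - x‖ ^ 2))).congr_deriv ?_
    push_cast
    ring
  have hanti := antitoneOn_of_hasDerivWithinAt_nonpos (convex_Icc (0 : ℝ) 1)
    (fun t _ ↦ (hderiv t).continuousAt.continuousWithinAt)
    (fun t _ ↦ (hderiv t).hasDerivWithinAt) (fun t ht ↦ by
      rw [interior_Icc] at ht
      have h1 := real_inner_le_norm (g' (x + t • (y - x)) - g' x) (y - x)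
      have h2 := hlip (x + t • (y - x)) x
      rw [add_sub_cancel_left, norm_smul, Real.norm_eq_abs, abs_of_pos ht.1] at h2
      rw [inner_sub_left] at h1
      linear_combination h1 + ‖y - x‖ * h2)
  have h := hanti (Set.left_mem_Icc.2 zero_le_one) (Set.right_mem_Icc.2 zero_le_one) zero_le_one
  simp only [one_smul, zero_smul, add_sub_cancel, add_zero] at h
  linarith

theorem stmt_12
    (L μ : ℝ) (hμ : 0 < μ) (hμL : μ ≤ L)
    (g : E → ℝ) (g' : E → E)
    (hgrad : ∀ w, HasGradientAt g (g' w) w)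
    (hlip : ∀ w w', ‖g' w - g' w'‖ ≤ L * ‖w - w'‖)
    (hsc : ∀ w w', g w + ⟪g' w, w' - w⟫ + μ / 2 * ‖w' - w‖ ^ 2 ≤ g w')
    :
    ∀ x y : E, ‖x - y - (1 / L) • (g' x - g' y)‖ ≤ (1 - μ / L) * ‖x - y‖ := by
  have hL : 0 < L := hμ.trans_le hμL
  have expand : ∀ u v : E, ⟪u - (1 / L) • g' u, v - u⟫
      = (‖v‖ ^ 2 - ‖u‖ ^ 2 - ‖v - u‖ ^ 2) / 2 - 1 / L * ⟪g' u, v - u⟫ := by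
    intro u v
    rw [inner_sub_left, real_inner_smul_left, inner_sub_right u v u, norm_sub_sq_real,
      real_inner_self_eq_norm_sq, real_inner_comm u v]
    ring
  intro x y
  have h := norm_sub_le_of_tangent_bounds (M := 1 - μ / L)
    (f := fun w ↦ ‖w‖ ^ 2 / 2 - 1 / L * g w) (f' := fun w ↦ w - (1 / L) • g' w) ?_ ?_ x y
  · convert h using 2
    rw [smul_sub]
    abel
  · intro u v
    have h := mul_le_mul_of_nonneg_left (le_tangent_add_of_lipschitz_gradient hgrad hlip u v)
      (one_div_pos.2 hL).le
    have e : 1 / L * L = 1 := one_div_mul_cancel hL.ne'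
    simp only [expand]
    linear_combination h + ‖v - u‖ ^ 2 / 2 * e
  · intro u v
    have h := mul_le_mul_of_nonneg_left (hsc u v) (one_div_pos.2 hL).le
    simp only [expand]
    linear_combination h
end
end
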